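/- arXiv:0906.0137 — 3 statements merged into one kernel-verified Lean document; each statement's English description precedes it below -/
import Mathlib

section
/- Let m > n and let a, b be words in the generators σ_1,…,σ_{n−1} representing the same element of B_n. Then d_m(a,b) ≥ d_n(a,b), where d_n and d_m denote the distances computed in B_n and B_m respectively: from any sequence of elementary modifications in B_m transforming a into b, deleting the last m−n strands from each intermediate braid diagram produces a sequence of elementary modifications in B_n from a to b in which the number of type (1) modifications does not increase. -/
namespace Braid

/-- A letter `σ_i^{±1}`: generator index `i` and sign (`true` = `σ_i`, `false` = `σ_i⁻¹`). -/
abbrev BraidLetter : Type := ℕ × Bool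

/-- A word in the braid generators: a finite sequence of letters `σ_i^{±1}`. -/
abbrev BraidWord : Type := List BraidLetter

/-- `w` is a word in the generators `σ_1, …, σ_{n-1}` of `B_n`. -/
def IsWord (n : ℕ) (w : BraidWord) : Prop := ∀ l ∈ w, 1 ≤ l.1 ∧ l.1 < n

/-- The relators of the braid group `B_n`, inside the free group on generators
indexed by `ℕ` (only the generators `σ_1, …, σ_{n-1}` are involved in relations,
so that on words in these generators the presented group is exactly `B_n`). -/
def braidRels (n : ℕ) : Set (FreeGroup ℕ) :=
  {r | ∃ i : ℕ, 1 ≤ i ∧ i + 2 ≤ n ∧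
      r = FreeGroup.of i * FreeGroup.of (i+1) * FreeGroup.of i *
          (FreeGroup.of (i+1) * FreeGroup.of i * FreeGroup.of (i+1))⁻¹} ∪
  {r | ∃ i j : ℕ, 1 ≤ i ∧ 1 ≤ j ∧ i < n ∧ j < n ∧ i + 2 ≤ j ∧
      r = FreeGroup.of i * FreeGroup.of j * (FreeGroup.of j * FreeGroup.of i)⁻¹}

/-- The braid group `B_n`, presented by the generators `σ_i` and the braid relations. -/
abbrev BraidGroup (n : ℕ) := PresentedGroup (braidRels n)

/-- The element of `B_n` represented by a single letter `σ_i^{±1}`. -/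
def evalLetter (n : ℕ) (l : BraidLetter) : BraidGroup n :=
  if l.2 then PresentedGroup.of l.1 else (PresentedGroup.of l.1)⁻¹

/-- The element of `B_n` represented by a word. -/
def eval (n : ℕ) (w : BraidWord) : BraidGroup n := (w.map (evalLetter n)).prod

/-- Type (1) elementary modification: replacing a subword `σ_i σ_{i+1} σ_i` by
`σ_{i+1} σ_i σ_{i+1}` or vice versa, `1 ≤ i ≤ n - 2`. -/
inductive Move1 (n : ℕ) : BraidWord → BraidWord → Prop
  | fwd (u v : BraidWord) (i : ℕ) (h1 : 1 ≤ i) (h2 : i + 2 ≤ n) :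
      Move1 n (u ++ [(i, true), (i+1, true), (i, true)] ++ v)
              (u ++ [(i+1, true), (i, true), (i+1, true)] ++ v)
  | bwd (u v : BraidWord) (i : ℕ) (h1 : 1 ≤ i) (h2 : i + 2 ≤ n) :
      Move1 n (u ++ [(i+1, true), (i, true), (i+1, true)] ++ v)
              (u ++ [(i, true), (i+1, true), (i, true)] ++ v)

/-- Type (2) elementary modification: replacing a subword `σ_i σ_j` by `σ_j σ_i`
for `|i - j| ≥ 2` (in either direction, as `i` and `j` are symmetric). -/
inductive Move2 (n : ℕ) : BraidWord → BraidWord → Prop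
  | swap (u v : BraidWord) (i j : ℕ) (h1 : 1 ≤ i) (h2 : 1 ≤ j)
      (h3 : i < n) (h4 : j < n) (h5 : i + 2 ≤ j ∨ j + 2 ≤ i) :
      Move2 n (u ++ [(i, true), (j, true)] ++ v)
              (u ++ [(j, true), (i, true)] ++ v)

/-- Type (3) elementary modification: deleting or inserting a subword
`σ_i σ_i⁻¹` or `σ_i⁻¹ σ_i`. -/
inductive Move3 (n : ℕ) : BraidWord → BraidWord → Prop
  | del (u v : BraidWord) (i : ℕ) (b : Bool) (h1 : 1 ≤ i) (h2 : i < n) :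
      Move3 n (u ++ [(i, b), (i, !b)] ++ v) (u ++ v)
  | ins (u v : BraidWord) (i : ℕ) (b : Bool) (h1 : 1 ≤ i) (h2 : i < n) :
      Move3 n (u ++ v) (u ++ [(i, b), (i, !b)] ++ v)

/-- `Reach n c a b`: there is a finite sequence of elementary modifications in `B_n`
transforming `a` into `b` and containing exactly `c` modifications of type (1). -/
inductive Reach (n : ℕ) : ℕ → BraidWord → BraidWord → Prop
  | refl (a : BraidWord) : Reach n 0 a a
  | step1 {a b c : BraidWord} {k : ℕ} : Move1 n a b → Reach n k b c → Reach n (k+1) a c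
  | step2 {a b c : BraidWord} {k : ℕ} : Move2 n a b → Reach n k b c → Reach n k a c
  | step3 {a b c : BraidWord} {k : ℕ} : Move3 n a b → Reach n k b c → Reach n k a c

/-- The distance `d(a,b)`: the minimal number of type (1) modifications among all
finite sequences of elementary modifications transforming `a` into `b`. -/
noncomputable def braidDist (n : ℕ) (a b : BraidWord) : ℕ := sInf {c | Reach n c a b}


/-! ### Basic properties of `Reach` -/

theorem Move1.symm {n : ℕ} {a b : BraidWord} (h : Move1 n a b) : Move1 n b a := by
  cases h with
  | fwd u v i h1 h2 => exact .bwd u v i h1 h2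
  | bwd u v i h1 h2 => exact .fwd u v i h1 h2

theorem Move2.symm {n : ℕ} {a b : BraidWord} (h : Move2 n a b) : Move2 n b a := by
  cases h with
  | swap u v i j h1 h2 h3 h4 h5 => exact .swap u v j i h2 h1 h4 h3 h5.symm

theorem Move3.symm {n : ℕ} {a b : BraidWord} (h : Move3 n a b) : Move3 n b a := by
  cases h with
  | del u v i s h1 h2 => exact .ins u v i s h1 h2
  | ins u v i s h1 h2 => exact .del u v i s h1 h2

theorem Move1.append {n : ℕ} {a b : BraidWord} (h : Move1 n a b) (x y : BraidWord) :
    Move1 n (x ++ a ++ y) (x ++ b ++ y) := by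
  cases h with
  | fwd u v i h1 h2 => simpa using Move1.fwd (x ++ u) (v ++ y) i h1 h2
  | bwd u v i h1 h2 => simpa using Move1.bwd (x ++ u) (v ++ y) i h1 h2

theorem Move2.append {n : ℕ} {a b : BraidWord} (h : Move2 n a b) (x y : BraidWord) :
    Move2 n (x ++ a ++ y) (x ++ b ++ y) := by
  cases h with
  | swap u v i j h1 h2 h3 h4 h5 =>
    simpa using Move2.swap (x ++ u) (v ++ y) i j h1 h2 h3 h4 h5

theorem Move3.append {n : ℕ} {a b : BraidWord} (h : Move3 n a b) (x y : BraidWord) :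
    Move3 n (x ++ a ++ y) (x ++ b ++ y) := by
  cases h with
  | del u v i s h1 h2 => simpa using Move3.del (x ++ u) (v ++ y) i s h1 h2
  | ins u v i s h1 h2 => simpa using Move3.ins (x ++ u) (v ++ y) i s h1 h2

theorem Reach.trans {n k l : ℕ} {a b c : BraidWord} (h : Reach n k a b) (h' : Reach n l b c) :
    Reach n (k + l) a c := by
  induction h with
  | refl a => simpa using h'
  | step1 hm _ ih => simpa [Nat.add_right_comm] using Reach.step1 hm (ih h')
  | step2 hm _ ih => exact .step2 hm (ih h')
  | step3 hm _ ih => exact .step3 hm (ih h')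

theorem Reach.symm {n k : ℕ} {a b : BraidWord} (h : Reach n k a b) : Reach n k b a := by
  induction h with
  | refl a => exact .refl a
  | step1 hm _ ih => exact ih.trans (.step1 hm.symm (.refl _))
  | step2 hm _ ih => exact ih.trans (.step2 hm.symm (.refl _))
  | step3 hm _ ih => exact ih.trans (.step3 hm.symm (.refl _))

theorem Reach.append {n k : ℕ} {a b : BraidWord} (h : Reach n k a b) (x y : BraidWord) :
    Reach n k (x ++ a ++ y) (x ++ b ++ y) := by
  induction h with
  | refl a => exact .refl _
  | step1 hm _ ih => exact .step1 (hm.append x y) ih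
  | step2 hm _ ih => exact .step2 (hm.append x y) ih
  | step3 hm _ ih => exact .step3 (hm.append x y) ih

theorem Move1.mono {n m : ℕ} (hnm : n ≤ m) {a b : BraidWord} (h : Move1 n a b) :
    Move1 m a b := by
  cases h with
  | fwd u v i h1 h2 => exact .fwd u v i h1 (h2.trans hnm)
  | bwd u v i h1 h2 => exact .bwd u v i h1 (h2.trans hnm)

theorem Move2.mono {n m : ℕ} (hnm : n ≤ m) {a b : BraidWord} (h : Move2 n a b) :
    Move2 m a b := by
  cases h with
  | swap u v i j h1 h2 h3 h4 h5 =>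
    exact .swap u v i j h1 h2 (h3.trans_le hnm) (h4.trans_le hnm) h5

theorem Move3.mono {n m : ℕ} (hnm : n ≤ m) {a b : BraidWord} (h : Move3 n a b) :
    Move3 m a b := by
  cases h with
  | del u v i s h1 h2 => exact .del u v i s h1 (h2.trans_le hnm)
  | ins u v i s h1 h2 => exact .ins u v i s h1 (h2.trans_le hnm)

theorem Reach.mono {n m k : ℕ} (hnm : n ≤ m) {a b : BraidWord} (h : Reach n k a b) :
    Reach m k a b := by
  induction h with
  | refl a => exact .refl a
  | step1 hm _ ih => exact .step1 (hm.mono hnm) ih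
  | step2 hm _ ih => exact .step2 (hm.mono hnm) ih
  | step3 hm _ ih => exact .step3 (hm.mono hnm) ih

/-! ### Words with the same value are connected by elementary modifications -/

/-- The congruence on words generated by the elementary modifications. -/
def reachCon (n : ℕ) : Con (FreeMonoid BraidLetter) where
  r a b := ∃ k, Reach n k a.toList b.toList
  iseqv := ⟨fun a => ⟨0, .refl _⟩, fun ⟨k, h⟩ => ⟨k, h.symm⟩,
    fun ⟨k, h⟩ ⟨l, h'⟩ => ⟨k + l, h.trans h'⟩⟩
  mul' := by
    rintro w x y z ⟨k, h⟩ ⟨l, h'⟩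
    have h1 := h.append [] y.toList
    have h2 := h'.append x.toList []
    simp only [List.nil_append, List.append_nil] at h1 h2
    exact ⟨k + l, h1.trans h2⟩

theorem reachCon_mk_eq {n : ℕ} {a b : BraidWord} :
    ((FreeMonoid.ofList a : FreeMonoid BraidLetter) : (reachCon n).Quotient) =
      (FreeMonoid.ofList b : FreeMonoid BraidLetter) ↔ ∃ k, Reach n k a b :=
  (reachCon n).eq

theorem reachCon_mk_append {n : ℕ} (a b : BraidWord) :
    ((FreeMonoid.ofList (a ++ b) : FreeMonoid BraidLetter) : (reachCon n).Quotient) =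
      (FreeMonoid.ofList a : FreeMonoid BraidLetter) *
      (FreeMonoid.ofList b : FreeMonoid BraidLetter) := rfl

open Classical in
/-- The unit of the quotient monoid represented by `σ_i`, and `1` if `i` is out of range. -/
noncomputable def genUnit (n i : ℕ) : (reachCon n).Quotientˣ :=
  if h : 1 ≤ i ∧ i < n then
    { val := (FreeMonoid.ofList [(i, true)] : FreeMonoid BraidLetter)
      inv := (FreeMonoid.ofList [(i, false)] : FreeMonoid BraidLetter)
      val_inv := by
        rw [← reachCon_mk_append]
        exact reachCon_mk_eq.2 ⟨0, .step3 (.del [] [] i true h.1 h.2) (.refl _)⟩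
      inv_val := by
        rw [← reachCon_mk_append]
        exact reachCon_mk_eq.2 ⟨0, .step3 (.del [] [] i false h.1 h.2) (.refl _)⟩ }
  else 1

theorem genUnit_val {n i : ℕ} (h : 1 ≤ i ∧ i < n) :
    (genUnit n i : (reachCon n).Quotient) =
      (FreeMonoid.ofList [(i, true)] : FreeMonoid BraidLetter) := by
  simp [genUnit, h]

theorem genUnit_inv_val {n i : ℕ} (h : 1 ≤ i ∧ i < n) :
    ((genUnit n i)⁻¹ : (reachCon n).Quotientˣ).val =
      (FreeMonoid.ofList [(i, false)] : FreeMonoid BraidLetter) := by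
  simp only [genUnit, h, and_self, dite_true]
  rfl

theorem lift_genUnit_eq_one {n : ℕ} :
    ∀ r ∈ braidRels n, FreeGroup.lift (genUnit n) r = 1 := by
  rintro r (⟨i, h1, h2, rfl⟩ | ⟨i, j, h1, h2, h3, h4, h5, rfl⟩)
  · rw [map_mul, map_inv, mul_inv_eq_one]
    ext
    simp only [map_mul, FreeGroup.lift_apply_of, Units.val_mul,
      genUnit_val (n := n) (i := i) ⟨h1, by omega⟩,
      genUnit_val (n := n) (i := i + 1) ⟨by omega, by omega⟩, ← reachCon_mk_append]
    exact reachCon_mk_eq.2 ⟨1, .step1 (.fwd [] [] i h1 h2) (.refl _)⟩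
  · rw [map_mul, map_inv, mul_inv_eq_one]
    ext
    simp only [map_mul, FreeGroup.lift_apply_of, Units.val_mul,
      genUnit_val (n := n) ⟨h1, h3⟩, genUnit_val (n := n) ⟨h2, h4⟩, ← reachCon_mk_append]
    exact reachCon_mk_eq.2 ⟨0, .step2 (.swap [] [] i j h1 h2 h3 h4 (.inl h5)) (.refl _)⟩

theorem toGroup_eval {n : ℕ} {w : BraidWord} (hw : IsWord n w) :
    (PresentedGroup.toGroup (lift_genUnit_eq_one (n := n)) (eval n w)).val =
      (FreeMonoid.ofList w : FreeMonoid BraidLetter) := by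
  induction w with
  | nil => simp [eval]
  | cons l w ih =>
    have hl := hw l (by simp)
    have hw' := ih fun x hx => hw x (by simp [hx])
    have he : eval n (l :: w) = evalLetter n l * eval n w := by simp [eval]
    rw [he, map_mul, Units.val_mul, hw', ← List.singleton_append, reachCon_mk_append]
    congr 1
    obtain ⟨i, s⟩ := l
    cases s
    · simpa [evalLetter] using genUnit_inv_val hl
    · simpa [evalLetter] using genUnit_val hl

theorem exists_reach_of_eval_eq {n : ℕ} {a b : BraidWord} (ha : IsWord n a) (hb : IsWord n b)
    (hab : eval n a = eval n b) : ∃ k, Reach n k a b := by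
  rw [← reachCon_mk_eq, ← toGroup_eval ha, ← toGroup_eval hb, hab]

/-! ### Deleting one strand -/

/-- The position after the crossing `σ_i^{±1}` of the strand in position `p`. -/
def stepPos (p i : ℕ) : ℕ := if p = i then i + 1 else if p = i + 1 then i else p

/-- What is left of a crossing after deleting the strand in position `p`. -/
def deleteLetter (p : ℕ) (l : BraidLetter) : BraidWord :=
  if l.1 + 1 < p then [l] else if p < l.1 then [(l.1 - 1, l.2)] else []

/-- The final position of the strand starting in position `p`. -/
def finalPos (p : ℕ) (w : BraidWord) : ℕ := w.foldl (fun q l => stepPos q l.1) p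

/-- The word obtained by deleting the strand starting in position `p`. -/
def deleteStrand : ℕ → BraidWord → BraidWord
  | _, [] => []
  | p, l :: w => deleteLetter p l ++ deleteStrand (stepPos p l.1) w

theorem deleteStrand_append (p : ℕ) (u v : BraidWord) :
    deleteStrand p (u ++ v) = deleteStrand p u ++ deleteStrand (finalPos p u) v := by
  induction u generalizing p with
  | nil => rfl
  | cons l u ih => simp [deleteStrand, ih, finalPos]

theorem finalPos_append (p : ℕ) (u v : BraidWord) :
    finalPos p (u ++ v) = finalPos (finalPos p u) v := by
  simp [finalPos]

theorem finalPos_mem {n p : ℕ} {w : BraidWord} (hw : IsWord (n + 1) w)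
    (hp : 1 ≤ p ∧ p ≤ n + 1) : 1 ≤ finalPos p w ∧ finalPos p w ≤ n + 1 := by
  induction w generalizing p with
  | nil => exact hp
  | cons l w ih =>
    have hl := hw l (by simp)
    refine ih (fun x hx => hw x (by simp [hx])) ?_
    unfold stepPos
    grind

theorem deleteStrand_of_isWord {n : ℕ} {w : BraidWord} (hw : IsWord n w) :
    deleteStrand (n + 1) w = w := by
  induction w with
  | nil => rfl
  | cons l w ih =>
    have hl := hw l (by simp)
    have h1 : stepPos (n + 1) l.1 = n + 1 := by unfold stepPos; grind
    simp [deleteStrand, h1, ih fun x hx => hw x (by simp [hx]), deleteLetter, hl.2]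

theorem isWord_append {n : ℕ} {u v : BraidWord} :
    IsWord n (u ++ v) ↔ IsWord n u ∧ IsWord n v := by
  simp only [IsWord, List.mem_append]
  grind

theorem Move1.isWord {n : ℕ} {a b : BraidWord} (h : Move1 n a b) (ha : IsWord n a) :
    IsWord n b := by
  cases h <;> simp [IsWord] at ha ⊢ <;> grind

theorem Move2.isWord {n : ℕ} {a b : BraidWord} (h : Move2 n a b) (ha : IsWord n a) :
    IsWord n b := by
  cases h; simp [IsWord] at ha ⊢; grind

theorem Move3.isWord {n : ℕ} {a b : BraidWord} (h : Move3 n a b) (ha : IsWord n a) :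
    IsWord n b := by
  cases h <;> simp [IsWord] at ha ⊢ <;> grind

theorem finalPos_braid (p i : ℕ) :
    finalPos p [(i, true), (i + 1, true), (i, true)] =
      finalPos p [(i + 1, true), (i, true), (i + 1, true)] := by
  simp only [finalPos, List.foldl, stepPos]
  grind

theorem finalPos_swap (p : ℕ) {i j : ℕ} (h : i + 2 ≤ j ∨ j + 2 ≤ i) :
    finalPos p [(i, true), (j, true)] = finalPos p [(j, true), (i, true)] := by
  simp only [finalPos, List.foldl, stepPos]
  grind

theorem finalPos_cancel (p i : ℕ) (s : Bool) : finalPos p [(i, s), (i, !s)] = p := by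
  simp only [finalPos, List.foldl, stepPos]
  grind

/-- Deleting a strand from both sides of a braid relation in `B_{n+1}`, either gives the same word
or a braid relation in `B_n`. -/
theorem deleteStrand_braid {n p i : ℕ} (hp : 1 ≤ p ∧ p ≤ n + 1) (h1 : 1 ≤ i)
    (h2 : i + 2 ≤ n + 1) :
    deleteStrand p [(i, true), (i + 1, true), (i, true)] =
      deleteStrand p [(i + 1, true), (i, true), (i + 1, true)] ∨
    ∃ k, 1 ≤ k ∧ k + 2 ≤ n ∧
      deleteStrand p [(i, true), (i + 1, true), (i, true)] =
        [(k, true), (k + 1, true), (k, true)] ∧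
      deleteStrand p [(i + 1, true), (i, true), (i + 1, true)] =
        [(k + 1, true), (k, true), (k + 1, true)] := by
  rcases lt_or_ge p i with h | h
  · obtain ⟨k, rfl⟩ : ∃ k, i = k + 1 := ⟨i - 1, by omega⟩
    refine .inr ⟨k, by omega, by omega, ?_⟩
    simp only [deleteStrand, deleteLetter, stepPos]
    grind
  · rcases lt_or_ge (i + 2) p with h' | h'
    · refine .inr ⟨i, by omega, by omega, ?_⟩
      simp only [deleteStrand, deleteLetter, stepPos]
      grind
    · left
      obtain rfl | rfl | rfl : p = i ∨ p = i + 1 ∨ p = i + 2 := by omega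
      all_goals
        simp only [deleteStrand, deleteLetter, stepPos]
        grind

theorem deleteStrand_swap {n p i j : ℕ} (hp : 1 ≤ p ∧ p ≤ n + 1) (h1 : 1 ≤ i) (h2 : 1 ≤ j)
    (h3 : i < n + 1) (h4 : j < n + 1) (h5 : i + 2 ≤ j ∨ j + 2 ≤ i) :
    deleteStrand p [(i, true), (j, true)] = deleteStrand p [(j, true), (i, true)] ∨
    ∃ k l, 1 ≤ k ∧ 1 ≤ l ∧ k < n ∧ l < n ∧ (k + 2 ≤ l ∨ l + 2 ≤ k) ∧
      deleteStrand p [(i, true), (j, true)] = [(k, true), (l, true)] ∧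
      deleteStrand p [(j, true), (i, true)] = [(l, true), (k, true)] := by
  by_cases h : (p = i ∨ p = i + 1) ∨ (p = j ∨ p = j + 1)
  · left
    simp only [deleteStrand, deleteLetter, stepPos]
    grind
  · refine .inr ⟨if p < i then i - 1 else i, if p < j then j - 1 else j, ?_⟩
    simp only [deleteStrand, deleteLetter, stepPos]
    grind

theorem deleteStrand_cancel {n p i : ℕ} (s : Bool) (hp : 1 ≤ p ∧ p ≤ n + 1) (h1 : 1 ≤ i)
    (h2 : i < n + 1) :
    deleteStrand p [(i, s), (i, !s)] = [] ∨
    ∃ k, 1 ≤ k ∧ k < n ∧ deleteStrand p [(i, s), (i, !s)] = [(k, s), (k, !s)] := by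
  by_cases h : p = i ∨ p = i + 1
  · left
    simp only [deleteStrand, deleteLetter, stepPos]
    grind
  · refine .inr ⟨if p < i then i - 1 else i, ?_⟩
    simp only [deleteStrand, deleteLetter, stepPos]
    grind

theorem Move1.deleteStrand {n p : ℕ} {a b : BraidWord} (h : Move1 (n + 1) a b)
    (ha : IsWord (n + 1) a) (hp : 1 ≤ p ∧ p ≤ n + 1) :
    deleteStrand p a = deleteStrand p b ∨ Move1 n (deleteStrand p a) (deleteStrand p b) := by
  cases h with
  | fwd u v i h1 h2 =>
    have hq := finalPos_mem (isWord_append.1 (isWord_append.1 ha).1).1 hp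
    simp only [deleteStrand_append, finalPos_append, finalPos_braid]
    rcases deleteStrand_braid hq h1 h2 with h | ⟨k, hk1, hk2, h, h'⟩
    · rw [h]; exact .inl rfl
    · rw [h, h']; exact .inr (.fwd _ _ k hk1 hk2)
  | bwd u v i h1 h2 =>
    have hq := finalPos_mem (isWord_append.1 (isWord_append.1 ha).1).1 hp
    simp only [deleteStrand_append, finalPos_append, finalPos_braid]
    rcases deleteStrand_braid hq h1 h2 with h | ⟨k, hk1, hk2, h, h'⟩
    · rw [h]; exact .inl rfl
    · rw [h, h']; exact .inr (.bwd _ _ k hk1 hk2)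

theorem Move2.deleteStrand {n p : ℕ} {a b : BraidWord} (h : Move2 (n + 1) a b)
    (ha : IsWord (n + 1) a) (hp : 1 ≤ p ∧ p ≤ n + 1) :
    deleteStrand p a = deleteStrand p b ∨ Move2 n (deleteStrand p a) (deleteStrand p b) := by
  cases h with
  | swap u v i j h1 h2 h3 h4 h5 =>
    have hq := finalPos_mem (isWord_append.1 (isWord_append.1 ha).1).1 hp
    simp only [deleteStrand_append, finalPos_append, finalPos_swap _ h5]
    rcases deleteStrand_swap hq h1 h2 h3 h4 h5 with h | ⟨k, l, hk, hl, hk', hl', hkl, h, h'⟩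
    · rw [h]; exact .inl rfl
    · rw [h, h']; exact .inr (.swap _ _ k l hk hl hk' hl' hkl)

theorem Move3.deleteStrand {n p : ℕ} {a b : BraidWord} (h : Move3 (n + 1) a b)
    (ha : IsWord (n + 1) a) (hp : 1 ≤ p ∧ p ≤ n + 1) :
    deleteStrand p a = deleteStrand p b ∨ Move3 n (deleteStrand p a) (deleteStrand p b) := by
  cases h with
  | del u v i s h1 h2 =>
    have hq := finalPos_mem (isWord_append.1 (isWord_append.1 ha).1).1 hp
    simp only [deleteStrand_append, finalPos_append, finalPos_cancel]
    rcases deleteStrand_cancel s hq h1 h2 with h | ⟨k, hk, hk', h⟩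
    · rw [h]; simp
    · rw [h]; exact .inr (.del _ _ k s hk hk')
  | ins u v i s h1 h2 =>
    have hq := finalPos_mem (isWord_append.1 ha).1 hp
    simp only [deleteStrand_append, finalPos_append, finalPos_cancel]
    rcases deleteStrand_cancel s hq h1 h2 with h | ⟨k, hk, hk', h⟩
    · rw [h]; simp
    · rw [h]; exact .inr (.ins _ _ k s hk hk')

theorem Reach.deleteStrand {n p c : ℕ} {a b : BraidWord} (h : Reach (n + 1) c a b)
    (ha : IsWord (n + 1) a) (hp : 1 ≤ p ∧ p ≤ n + 1) :
    ∃ c' ≤ c, Reach n c' (deleteStrand p a) (deleteStrand p b) := by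
  induction h with
  | refl a => exact ⟨0, le_rfl, .refl _⟩
  | step1 hm _ ih =>
    obtain ⟨c', hc, hr⟩ := ih (hm.isWord ha)
    rcases hm.deleteStrand ha hp with he | hm'
    · exact ⟨c', by omega, he ▸ hr⟩
    · exact ⟨c' + 1, by omega, .step1 hm' hr⟩
  | step2 hm _ ih =>
    obtain ⟨c', hc, hr⟩ := ih (hm.isWord ha)
    rcases hm.deleteStrand ha hp with he | hm'
    · exact ⟨c', hc, he ▸ hr⟩
    · exact ⟨c', hc, .step2 hm' hr⟩
  | step3 hm _ ih =>
    obtain ⟨c', hc, hr⟩ := ih (hm.isWord ha)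
    rcases hm.deleteStrand ha hp with he | hm'
    · exact ⟨c', hc, he ▸ hr⟩
    · exact ⟨c', hc, .step3 hm' hr⟩

theorem IsWord.mono {n m : ℕ} (hnm : n ≤ m) {w : BraidWord} (hw : IsWord n w) : IsWord m w :=
  fun l hl => ⟨(hw l hl).1, (hw l hl).2.trans_le hnm⟩

theorem Reach.exists_le_of_isWord {n m c : ℕ} (hnm : n ≤ m) {a b : BraidWord}
    (ha : IsWord n a) (hb : IsWord n b) (h : Reach m c a b) : ∃ c' ≤ c, Reach n c' a b := by
  induction m, hnm using Nat.le_induction generalizing c with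
  | base => exact ⟨c, le_rfl, h⟩
  | succ m hnm ih =>
    obtain ⟨c₁, hc₁, h₁⟩ := h.deleteStrand (p := m + 1) (ha.mono (by omega)) ⟨by omega, le_rfl⟩
    rw [deleteStrand_of_isWord (ha.mono hnm), deleteStrand_of_isWord (hb.mono hnm)] at h₁
    obtain ⟨c₂, hc₂, h₂⟩ := ih h₁
    exact ⟨c₂, hc₂.trans hc₁, h₂⟩

/-- For `m > n` and words `a, b` in the generators `σ_1, …, σ_{n-1}` representing
the same element of `B_n`, we have `d_m(a,b) ≥ d_n(a,b)`: from any sequence of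
elementary modifications in `B_m` from `a` to `b` one obtains a sequence of
elementary modifications in `B_n` from `a` to `b` in which the number of type (1)
modifications does not increase. -/
theorem statement_3 (n m : ℕ) (hnm : n < m) (a b : BraidWord)
    (ha : IsWord n a) (hb : IsWord n b) (hab : eval n a = eval n b) :
    braidDist n a b ≤ braidDist m a b ∧
    (∀ c : ℕ, Reach m c a b → ∃ c' : ℕ, c' ≤ c ∧ Reach n c' a b) := by
  refine ⟨?_, fun c h => h.exists_le_of_isWord hnm.le ha hb⟩
  obtain ⟨k, hk⟩ := exists_reach_of_eval_eq ha hb hab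
  have hmin : Reach m (braidDist m a b) a b :=
    Nat.sInf_mem (s := {c | Reach m c a b}) ⟨k, hk.mono hnm.le⟩
  obtain ⟨c', hc', h⟩ := hmin.exists_le_of_isWord hnm.le ha hb
  exact (Nat.sInf_le h).trans hc'

end Braid
end

section
/- For every k ≥ 1, d(a_k, b_k) ≤ 4k²: there is a sequence of elementary modifications transforming a_k = W^{−k} V^k W^k V^{−k} into b_k = W^{−k} W^k V^k V^{−k} that uses exactly 4k² applications of the relation σ_1σ_2σ_1 = σ_2σ_1σ_2 (sliding the V^k portion through the W^k portion). -/
namespace Braid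

/-- The `k`-fold concatenation `w^k` of a word. -/
def wpow (w : BraidWord) (k : ℕ) : BraidWord := (List.replicate k w).flatten

/-- The formal inverse `w⁻¹` of a word: letters inverted and order reversed. -/
def winv (w : BraidWord) : BraidWord := w.reverse.map (fun l => (l.1, !l.2))

/-- The word `V = σ_1²`. -/
def V : BraidWord := [(1, true), (1, true)]

/-- The word `W = σ_2 σ_1² σ_2`. -/
def W : BraidWord := [(2, true), (1, true), (1, true), (2, true)]

/-- The word `a_k = W^{-k} V^k W^k V^{-k}`. -/
def ak (k : ℕ) : BraidWord := winv (wpow W k) ++ wpow V k ++ wpow W k ++ winv (wpow V k)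

/-- The word `b_k = W^{-k} W^k V^k V^{-k}`. -/
def bk (k : ℕ) : BraidWord := winv (wpow W k) ++ wpow W k ++ wpow V k ++ winv (wpow V k)


theorem Move1.context {n : ℕ} {a b : BraidWord} (h : Move1 n a b) (p q : BraidWord) :
    Move1 n (p ++ a ++ q) (p ++ b ++ q) := by
  cases h with
  | fwd u v i h1 h2 => simpa using Move1.fwd (p ++ u) (v ++ q) i h1 h2
  | bwd u v i h1 h2 => simpa using Move1.bwd (p ++ u) (v ++ q) i h1 h2

theorem Move2.context {n : ℕ} {a b : BraidWord} (h : Move2 n a b) (p q : BraidWord) :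
    Move2 n (p ++ a ++ q) (p ++ b ++ q) := by
  cases h with
  | swap u v i j h1 h2 h3 h4 h5 =>
    simpa using Move2.swap (p ++ u) (v ++ q) i j h1 h2 h3 h4 h5

theorem Move3.context {n : ℕ} {a b : BraidWord} (h : Move3 n a b) (p q : BraidWord) :
    Move3 n (p ++ a ++ q) (p ++ b ++ q) := by
  cases h with
  | del u v i s h1 h2 => simpa using Move3.del (p ++ u) (v ++ q) i s h1 h2
  | ins u v i s h1 h2 => simpa using Move3.ins (p ++ u) (v ++ q) i s h1 h2

theorem Reach.context {n c : ℕ} {a b : BraidWord} (h : Reach n c a b) (p q : BraidWord) :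
    Reach n c (p ++ a ++ q) (p ++ b ++ q) := by
  induction h with
  | refl a => exact .refl _
  | step1 m _ ih => exact .step1 (m.context p q) ih
  | step2 m _ ih => exact .step2 (m.context p q) ih
  | step3 m _ ih => exact .step3 (m.context p q) ih

theorem Reach.trans_s7 {n c d : ℕ} {x y z : BraidWord} (h : Reach n c x y) (h' : Reach n d y z) :
    Reach n (c + d) x z := by
  induction h with
  | refl a => simpa using h'
  | step1 m _ ih => rw [Nat.add_right_comm]; exact .step1 m (ih h')
  | step2 m _ ih => exact .step2 m (ih h')
  | step3 m _ ih => exact .step3 m (ih h')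

theorem Reach.append_comm_append_left {n c d : ℕ} {x y z : BraidWord}
    (h : Reach n c (x ++ z) (z ++ x)) (h' : Reach n d (y ++ z) (z ++ y)) :
    Reach n (d + c) ((x ++ y) ++ z) (z ++ (x ++ y)) := by
  have h₁ := h'.context x []
  have h₂ := h.context [] y
  simp only [List.append_assoc, List.append_nil, List.nil_append] at h₁ h₂ ⊢
  exact h₁.trans_s7 h₂

theorem Reach.append_comm_append_right {n c d : ℕ} {x y z : BraidWord}
    (h : Reach n c (x ++ y) (y ++ x)) (h' : Reach n d (x ++ z) (z ++ x)) :
    Reach n (c + d) (x ++ (y ++ z)) ((y ++ z) ++ x) := by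
  have h₁ := h.context [] z
  have h₂ := h'.context y []
  simp only [List.append_assoc, List.append_nil, List.nil_append] at h₁ h₂ ⊢
  exact h₁.trans_s7 h₂

theorem wpow_succ (w : BraidWord) (k : ℕ) : wpow w (k + 1) = w ++ wpow w k := by
  simp [wpow, List.replicate_succ]

theorem Reach.wpow_append_comm {n c : ℕ} {x y : BraidWord} (h : Reach n c (x ++ y) (y ++ x))
    (k : ℕ) : Reach n (k * c) (wpow x k ++ y) (y ++ wpow x k) := by
  induction k with
  | zero => simpa [wpow] using Reach.refl y
  | succ k ih =>
    rw [wpow_succ, Nat.succ_mul]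
    exact h.append_comm_append_left ih

theorem Reach.append_wpow_comm {n c : ℕ} {x y : BraidWord} (h : Reach n c (x ++ y) (y ++ x))
    (k : ℕ) : Reach n (k * c) (x ++ wpow y k) (wpow y k ++ x) := by
  induction k with
  | zero => simpa [wpow] using Reach.refl x
  | succ k ih =>
    rw [wpow_succ, Nat.succ_mul, Nat.add_comm]
    exact h.append_comm_append_right ih

/-- `σ₁ · σ₂σ₁σ₁σ₂ → σ₂σ₁σ₂σ₁σ₂ → σ₂σ₁σ₁σ₂ · σ₁`. -/
theorem reach_sigma_one_append_W : Reach 3 2 ([(1, true)] ++ W) (W ++ [(1, true)]) :=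
  .step1 (.fwd [] [(1, true), (2, true)] 1 le_rfl le_rfl) <|
    .step1 (.bwd [(2, true), (1, true)] [] 1 le_rfl le_rfl) (.refl _)

theorem reach_V_append_W : Reach 3 4 (V ++ W) (W ++ V) :=
  reach_sigma_one_append_W.append_comm_append_left reach_sigma_one_append_W

/-- For every `k ≥ 1`, `d(a_k, b_k) ≤ 4k²`: there is a sequence of elementary
modifications from `a_k` to `b_k` using exactly `4k²` applications of the relation
`σ_1σ_2σ_1 = σ_2σ_1σ_2`. -/
theorem statement_7 (k : ℕ) (hk : 1 ≤ k) :
    braidDist 3 (ak k) (bk k) ≤ 4 * k ^ 2 ∧ Reach 3 (4 * k ^ 2) (ak k) (bk k) := by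
  have h : Reach 3 (4 * k ^ 2) (ak k) (bk k) := by
    have := ((reach_V_append_W.append_wpow_comm k).wpow_append_comm k).context
      (winv (wpow W k)) (winv (wpow V k))
    rw [show 4 * k ^ 2 = k * (k * 4) by ring]
    simpa only [ak, bk, List.append_assoc] using this
  exact ⟨Nat.sInf_le h, h⟩

end Braid
end

section
/- For every n ≥ 3 there exist a constant c > 0 and a sequence of words {a_k}_{k≥1} in the generators σ_1,…,σ_{n−1} of B_n, each representing the identity element, with lengths ℓ_k → ∞, such that every sequence of elementary modifications transforming a_k into the empty word contains at least c·ℓ_k² modifications of type (1); in particular the number of applications of the braid relations σ_iσ_{i+1}σ_i = σ_{i+1}σ_iσ_{i+1} needed to trivialize a_k is at least quadratic in the length of a_k, even when commutativity relations and free cancellations are not counted. -/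
namespace Braid

/-- `1` if `{a, b} = {p, q}`, and `0` otherwise. -/
def pairInd (p q a b : ℕ) : ℤ := if (a = p ∧ b = q) ∨ (a = q ∧ b = p) then 1 else 0

/-- The sign of a letter. -/
def letterSign (l : BraidLetter) : ℤ := if l.2 then 1 else -1

/-- The state reached while reading a braid word: the strand at each position, the algebraic number
of crossings between the strands `1` and `2`, and the signed number of pairs consisting of a
crossing of the strands `1, 2` followed by a crossing of the strands `2, 3`. -/
abbrev CrossingState : Type := Equiv.Perm ℕ × ℤ × ℤ

/-- The effect of one letter on the crossing state. -/
def readLetter (s : CrossingState) (l : BraidLetter) : CrossingState :=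
  (s.1 * Equiv.swap l.1 (l.1 + 1),
   s.2.1 + letterSign l * pairInd 1 2 (s.1 l.1) (s.1 (l.1 + 1)),
   s.2.2 + s.2.1 * (letterSign l * pairInd 2 3 (s.1 l.1) (s.1 (l.1 + 1))))

/-- The effect of a word on the crossing state. -/
def readWord (s : CrossingState) (w : BraidWord) : CrossingState := w.foldl readLetter s

/-- The number of crossings of the strands `1, 2` followed by crossings of the strands `2, 3`,
counted with signs. -/
def crossingArea (w : BraidWord) : ℤ := (readWord (1, 0, 0) w).2.2

lemma readWord_append (s : CrossingState) (u v : BraidWord) :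
    readWord s (u ++ v) = readWord (readWord s u) v := by
  simp [readWord]

lemma readWord_area_sub (v : BraidWord) (π : Equiv.Perm ℕ) (x A B : ℤ) :
    (readWord (π, x, A) v).2.2 - (readWord (π, x, B) v).2.2 = A - B := by
  induction v generalizing π x A B with
  | nil => rfl
  | cons l v ih =>
    simp only [readWord, List.foldl_cons] at ih ⊢
    refine (ih _ _ _ _).trans ?_
    simp

lemma abs_crossingArea_sub_le {m m' : BraidWord} {d : ℤ}
    (h : ∀ s : CrossingState, (readWord s m).1 = (readWord s m').1 ∧
      (readWord s m).2.1 = (readWord s m').2.1 ∧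
      |(readWord s m).2.2 - (readWord s m').2.2| ≤ d) (u v : BraidWord) :
    |crossingArea (u ++ m ++ v) - crossingArea (u ++ m' ++ v)| ≤ d := by
  simp only [crossingArea, readWord_append]
  obtain ⟨h1, h2, h3⟩ := h (readWord (1, 0, 0) u)
  generalize readWord (readWord (1, 0, 0) u) m = s at *
  generalize readWord (readWord (1, 0, 0) u) m' = s' at *
  obtain ⟨π, x, A⟩ := s
  obtain ⟨π', x', A'⟩ := s'
  subst h1 h2
  rwa [readWord_area_sub]

lemma swap_braid (i : ℕ) :
    Equiv.swap i (i + 1) * Equiv.swap (i + 1) (i + 1 + 1) * Equiv.swap i (i + 1) =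
      Equiv.swap (i + 1) (i + 1 + 1) * Equiv.swap i (i + 1) *
        Equiv.swap (i + 1) (i + 1 + 1) := by
  ext k
  simp only [Equiv.Perm.mul_apply, Equiv.swap_apply_def]
  grind

lemma swap_comm_of_far {i j : ℕ} (h : i + 2 ≤ j ∨ j + 2 ≤ i) :
    Equiv.swap i (i + 1) * Equiv.swap j (j + 1) =
      Equiv.swap j (j + 1) * Equiv.swap i (i + 1) := by
  ext k
  simp only [Equiv.Perm.mul_apply, Equiv.swap_apply_def]
  grind

lemma pairInd_comm (p q a b : ℕ) : pairInd p q a b = pairInd p q b a := by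
  simp only [pairInd]
  grind

lemma abs_crossingArea_braid_le (u v : BraidWord) (i : ℕ) :
    |crossingArea (u ++ [(i, true), (i+1, true), (i, true)] ++ v) -
      crossingArea (u ++ [(i+1, true), (i, true), (i+1, true)] ++ v)| ≤ 1 := by
  refine abs_crossingArea_sub_le (fun s => ?_) u v
  obtain ⟨π, x, A⟩ := s
  have hab : π i ≠ π (i + 1) := by simp
  have hac : π i ≠ π (i + 1 + 1) := by simp; omega
  have hbc : π (i + 1) ≠ π (i + 1 + 1) := by simp
  have e1 : Equiv.swap i (i + 1) (i + 1 + 1) = i + 1 + 1 :=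
    Equiv.swap_apply_of_ne_of_ne (by omega) (by omega)
  have e2 : Equiv.swap (i + 1) (i + 1 + 1) i = i :=
    Equiv.swap_apply_of_ne_of_ne (by omega) (by omega)
  simp only [readWord, List.foldl_cons, List.foldl_nil, readLetter, letterSign,
    Equiv.Perm.mul_apply, e1, e2, Equiv.swap_apply_left, Equiv.swap_apply_right, if_true, one_mul]
  refine ⟨by simpa only [mul_assoc] using congrArg (π * ·) (swap_braid i), by ring, ?_⟩
  generalize π i = a at *
  generalize π (i + 1) = b at *
  generalize π (i + 1 + 1) = c at *
  simp only [pairInd]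
  rw [abs_le]
  split_ifs <;> omega

lemma crossingArea_swap (u v : BraidWord) {i j : ℕ} (h : i + 2 ≤ j ∨ j + 2 ≤ i) :
    crossingArea (u ++ [(i, true), (j, true)] ++ v) =
      crossingArea (u ++ [(j, true), (i, true)] ++ v) := by
  rw [← sub_eq_zero, ← abs_nonpos_iff]
  refine abs_crossingArea_sub_le (fun s => ?_) u v
  obtain ⟨π, x, A⟩ := s
  have e1 : Equiv.swap i (i + 1) j = j :=
    Equiv.swap_apply_of_ne_of_ne (by omega) (by omega)
  have e2 : Equiv.swap i (i + 1) (j + 1) = j + 1 :=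
    Equiv.swap_apply_of_ne_of_ne (by omega) (by omega)
  have e3 : Equiv.swap j (j + 1) i = i :=
    Equiv.swap_apply_of_ne_of_ne (by omega) (by omega)
  have e4 : Equiv.swap j (j + 1) (i + 1) = i + 1 :=
    Equiv.swap_apply_of_ne_of_ne (by omega) (by omega)
  have h1 : π i ≠ π j := by simp; omega
  have h2 : π i ≠ π (j + 1) := by simp; omega
  have h3 : π (i + 1) ≠ π j := by simp; omega
  have h4 : π (i + 1) ≠ π (j + 1) := by simp; omega
  simp only [readWord, List.foldl_cons, List.foldl_nil, readLetter, letterSign,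
    Equiv.Perm.mul_apply, e1, e2, e3, e4, if_true, one_mul]
  refine ⟨by simp only [mul_assoc, swap_comm_of_far h], by ring, ?_⟩
  generalize π i = a at *
  generalize π (i + 1) = b at *
  generalize π j = c at *
  generalize π (j + 1) = d at *
  simp only [pairInd]
  rw [abs_nonpos_iff]
  split_ifs <;> omega

lemma crossingArea_cancel (u v : BraidWord) (i : ℕ) (b : Bool) :
    crossingArea (u ++ [(i, b), (i, !b)] ++ v) = crossingArea (u ++ v) := by
  have key : |crossingArea (u ++ [(i, b), (i, !b)] ++ v) - crossingArea (u ++ [] ++ v)| ≤ 0 := by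
    refine abs_crossingArea_sub_le (fun s => ?_) u v
    obtain ⟨π, x, A⟩ := s
    simp only [readWord, List.foldl_cons, List.foldl_nil, readLetter, letterSign,
      Equiv.Perm.mul_apply, Equiv.swap_apply_left, Equiv.swap_apply_right]
    rw [pairInd_comm 1 2 (π (i + 1)), pairInd_comm 2 3 (π (i + 1))]
    refine ⟨by simp [mul_assoc], by cases b <;> simp, ?_⟩
    rw [abs_nonpos_iff]
    simp only [pairInd]
    cases b <;>
    · simp only [Bool.not_true, Bool.not_false, if_true, Bool.false_eq_true, if_false]
      split_ifs <;> omega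
  rw [abs_nonpos_iff, sub_eq_zero, List.append_nil] at key
  exact key

lemma Reach.abs_crossingArea_sub_le {n m : ℕ} {a b : BraidWord} (h : Reach n m a b) :
    |crossingArea a - crossingArea b| ≤ m := by
  induction h with
  | refl a => simp
  | @step1 a b c k h _ ih =>
    have h1 : |crossingArea a - crossingArea b| ≤ 1 := by
      cases h with
      | fwd u v i => exact abs_crossingArea_braid_le u v i
      | bwd u v i => rw [abs_sub_comm]; exact abs_crossingArea_braid_le u v i
    have h2 := abs_sub_le (crossingArea a) (crossingArea b) (crossingArea c)
    push_cast
    linarith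
  | step2 h _ ih =>
    cases h with
    | swap u v i j _ _ _ _ h5 => rwa [crossingArea_swap u v h5]
  | step3 h _ ih =>
    cases h with
    | del u v i b => rwa [crossingArea_cancel]
    | ins u v i b => rwa [crossingArea_cancel] at ih

/-- The `k`-th power of a word. -/
def wordPow (w : BraidWord) (k : ℕ) : BraidWord := (List.replicate k w).flatten

/-- The word `σ_1²` or its inverse. -/
def twist (b : Bool) : BraidWord := [(1, b), (1, b)]

/-- The word `(σ_1 σ_2 σ_1)²`, the full twist on three strands, or its inverse. -/
def fullTwist (b : Bool) : BraidWord := [(1, b), (2, b), (1, b), (1, b), (2, b), (1, b)]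

/-- The commutator of `σ_1^{2k}` with the `k`-th power of the full twist on three strands. -/
def twistCommutator (k : ℕ) : BraidWord :=
  wordPow (twist true) k ++ wordPow (fullTwist true) k ++
    wordPow (twist false) k ++ wordPow (fullTwist false) k

lemma wordPow_succ (w : BraidWord) (k : ℕ) : wordPow w (k + 1) = w ++ wordPow w k := by
  simp [wordPow, List.replicate_succ]

lemma length_twistCommutator (k : ℕ) : (twistCommutator k).length = 16 * k := by
  simp [twistCommutator, wordPow, twist, fullTwist]
  ring

lemma readWord_twist (x A : ℤ) (b : Bool) :
    readWord (1, x, A) (twist b) = (1, x + 2 * (if b then 1 else -1), A) := by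
  cases b <;>
  · simp [readWord, twist, readLetter, letterSign, pairInd]
    ring

lemma readWord_fullTwist (x A : ℤ) (b : Bool) :
    readWord (1, x, A) (fullTwist b) =
      (1, x + 2 * (if b then 1 else -1), A + 2 * (if b then 1 else -1) * x + 2) := by
  cases b <;>
  · simp [readWord, fullTwist, readLetter, letterSign, pairInd, Equiv.swap_apply_def]
    constructor <;> ring

lemma readWord_wordPow_twist (x A : ℤ) (b : Bool) (k : ℕ) :
    readWord (1, x, A) (wordPow (twist b) k) = (1, x + 2 * k * (if b then 1 else -1), A) := by
  induction k generalizing x with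
  | zero => simp [wordPow, readWord]
  | succ k ih =>
    rw [wordPow_succ, readWord_append, readWord_twist, ih]
    push_cast
    congr 2
    ring

lemma readWord_wordPow_fullTwist (x A : ℤ) (b : Bool) (k : ℕ) :
    readWord (1, x, A) (wordPow (fullTwist b) k) =
      (1, x + 2 * k * (if b then 1 else -1),
        A + 2 * k * (if b then 1 else -1) * x + 2 * (k : ℤ) ^ 2) := by
  induction k generalizing x A with
  | zero => simp [wordPow, readWord]
  | succ k ih =>
    rw [wordPow_succ, readWord_append, readWord_fullTwist, ih]
    push_cast
    cases b <;>
    · simp only [if_true, Bool.false_eq_true, if_false]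
      congr 2 <;> ring

lemma crossingArea_twistCommutator (k : ℕ) :
    crossingArea (twistCommutator k) = 4 * (k : ℤ) ^ 2 := by
  simp only [crossingArea, twistCommutator, readWord_append, readWord_wordPow_twist,
    readWord_wordPow_fullTwist, if_true, Bool.false_eq_true, if_false]
  ring

lemma eval_append (n : ℕ) (u v : BraidWord) : eval n (u ++ v) = eval n u * eval n v := by
  simp [eval]

lemma eval_wordPow (n : ℕ) (w : BraidWord) (k : ℕ) :
    eval n (wordPow w k) = eval n w ^ k := by
  induction k with
  | zero => simp [wordPow, eval]
  | succ k ih => rw [wordPow_succ, eval_append, ih, pow_succ']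

lemma commute_twist_fullTwist {G : Type*} [Group G] {g h : G} (hgh : g * h * g = h * g * h) :
    Commute (g * g) (g * h * g * (g * h * g)) := by
  have h1 : g * (g * h * g) = g * h * g * h := by
    rw [hgh]; simp only [← mul_assoc]; rw [hgh]
  have h2 : h * (g * h * g) = g * h * g * g := by
    rw [← mul_assoc, ← mul_assoc, ← hgh]
  have h3 : Commute g (g * h * g * (g * h * g)) := by
    rw [Commute, SemiconjBy, ← mul_assoc, h1, mul_assoc, h2, ← mul_assoc, ← mul_assoc]
  exact h3.mul_left h3

lemma eval_twistCommutator {n : ℕ} (hn : 3 ≤ n) (k : ℕ) : eval n (twistCommutator k) = 1 := by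
  have hrel : (PresentedGroup.of 1 * PresentedGroup.of 2 * PresentedGroup.of 1 : BraidGroup n) =
      PresentedGroup.of 2 * PresentedGroup.of 1 * PresentedGroup.of 2 := by
    rw [← mul_inv_eq_one]
    exact PresentedGroup.one_of_mem (Or.inl ⟨1, le_rfl, hn, rfl⟩)
  have hc := (commute_twist_fullTwist hrel).pow_pow k k
  have ht : eval n (twist false) = (eval n (twist true))⁻¹ := by
    simp [eval, twist, evalLetter]
  have hf : eval n (fullTwist false) = (eval n (fullTwist true))⁻¹ := by
    simp [eval, fullTwist, evalLetter, mul_assoc]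
  have hcomm : Commute (eval n (twist true) ^ k) (eval n (fullTwist true) ^ k) := by
    simpa [eval, twist, fullTwist, evalLetter, mul_assoc] using hc
  simp only [twistCommutator, eval_append, eval_wordPow, ht, hf, inv_pow]
  rw [hcomm.eq]
  group

lemma isWord_twistCommutator {n : ℕ} (hn : 3 ≤ n) (k : ℕ) : IsWord n (twistCommutator k) := by
  intro l hl
  simp only [twistCommutator, wordPow, twist, fullTwist, List.mem_append, List.mem_flatten,
    List.mem_replicate] at hl
  have h : l.1 = 1 ∨ l.1 = 2 := by
    rcases hl with ((⟨w, ⟨-, rfl⟩, hl⟩ | ⟨w, ⟨-, rfl⟩, hl⟩) | ⟨w, ⟨-, rfl⟩, hl⟩) |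
      ⟨w, ⟨-, rfl⟩, hl⟩ <;> simp at hl <;> grind
  omega

/-- For every `n ≥ 3` there are a constant `c > 0` and a sequence of words `a_k` in
the generators `σ_1, …, σ_{n-1}` of `B_n`, each representing the identity element,
with lengths tending to infinity, such that every sequence of elementary
modifications transforming `a_k` into the empty word contains at least
`c · (length a_k)²` modifications of type (1). -/
theorem statement_13 (n : ℕ) (hn : 3 ≤ n) :
    ∃ (c : ℝ) (a : ℕ → BraidWord), 0 < c ∧
      (∀ k : ℕ, 1 ≤ k → IsWord n (a k) ∧ eval n (a k) = 1) ∧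
      Filter.Tendsto (fun k => (a k).length) Filter.atTop Filter.atTop ∧
      (∀ k : ℕ, 1 ≤ k → ∀ m : ℕ, Reach n m (a k) [] →
        c * ((a k).length : ℝ) ^ 2 ≤ (m : ℝ)) := by
  refine ⟨1 / 64, twistCommutator, by norm_num,
    fun k _ => ⟨isWord_twistCommutator hn k, eval_twistCommutator hn k⟩, ?_, fun k _ m hm => ?_⟩
  · simp only [length_twistCommutator]
    exact Filter.tendsto_id.const_mul_atTop' (by norm_num)
  · have h := (le_abs_self _).trans hm.abs_crossingArea_sub_le
    have h0 : crossingArea [] = 0 := rfl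
    rw [crossingArea_twistCommutator, h0, sub_zero] at h
    have h' : 4 * (k : ℝ) ^ 2 ≤ m := by exact_mod_cast h
    rw [length_twistCommutator]
    push_cast
    linarith

end Braid
end
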